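/- Let A ∈ ℝ^{n×n} be symmetric with zero diagonal and no zero row, δ_i := Σ_j |A_{ij}|, Δ := diag(δ_1,…,δ_n), let ψ_1,…,ψ_n satisfy (A.1)–(A.4), let π > 0, and let ε > 0 satisfy 1 − ε·max_i δ_i ≥ 0. If the symmetric matrices L_π := Δ − πA and 2I − εL_π are both positive definite, then the origin is the unique fixed point of the map F(x) := (I − εΔ)x + επAψ(x), and it is globally asymptotically stable: for every initial condition x_0 ∈ ℝ^n, the iterates F^k(x_0) converge to 0 as k → ∞. -/

import Mathlib

open Matrix Filter Set

/-- The eigenvalues of a real symmetric (Hermitian) matrix, sorted in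
nondecreasing order: `lambdaSorted M ⟨0,_⟩ = λ_1 ≤ … ≤ lambdaSorted M ⟨n-1,_⟩ = λ_n`.
Junk value `0` if `M` is not Hermitian. -/
noncomputable def lambdaSorted {n : ℕ} (M : Matrix (Fin n) (Fin n) ℝ) : Fin n → ℝ :=
  if hM : M.IsHermitian then hM.eigenvalues ∘ ⇑(Tuple.sort hM.eigenvalues) else 0

/-- The largest eigenvalue `λ_max = λ_n` of a real symmetric matrix. -/
noncomputable def lambdaMax {n : ℕ} (M : Matrix (Fin n) (Fin n) ℝ) : ℝ :=
  ⨆ i, lambdaSorted M i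

/-- The smallest eigenvalue `λ_min = λ_1` of a real symmetric matrix. -/
noncomputable def lambdaMin {n : ℕ} (M : Matrix (Fin n) (Fin n) ℝ) : ℝ :=
  ⨅ i, lambdaSorted M i

/-- Assumptions (A.1)–(A.4) on the nonlinearities `ψ_i`: continuously
differentiable, odd, monotone with unit slope at the origin, saturated at `±1`,
and sigmoidal (strictly convex for `x<0`, strictly concave for `x>0`). -/
structure IsSigmoid (ψ : ℝ → ℝ) : Prop where
  contDiff : ContDiff ℝ 1 ψ
  odd : ∀ y : ℝ, ψ (-y) = -ψ y
  deriv_pos : ∀ y : ℝ, 0 < deriv ψ y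
  deriv_zero : deriv ψ 0 = 1
  tendsto_atTop : Tendsto ψ atTop (nhds 1)
  tendsto_atBot : Tendsto ψ atBot (nhds (-1))
  strictConvexOn : StrictConvexOn ℝ (Iio (0:ℝ)) ψ
  strictConcaveOn : StrictConcaveOn ℝ (Ioi (0:ℝ)) ψ

/-- The value `±1` associated to a Boolean sign. -/
def signVal (b : Bool) : ℝ := if b then 1 else -1

/-- `max_{s ∈ {−1,1}^n} sᵀ H s`, which equals `n − 2ε(𝒢)` for the normalized
interaction matrix `H` of a signed graph with frustration index `ε(𝒢)`. -/
noncomputable def maxCut {n : ℕ} (H : Matrix (Fin n) (Fin n) ℝ) : ℝ :=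
  ⨆ s : Fin n → Bool, (fun i => signVal (s i)) ⬝ᵥ H.mulVec (fun i => signVal (s i))

/-- The sign function with `sgn 0 = 1`. -/
noncomputable def sgn (y : ℝ) : ℝ := if 0 ≤ y then 1 else -1

theorem aux_psi_zero {ψ : ℝ → ℝ} (h : IsSigmoid ψ) : ψ 0 = 0 := by
  have := h.odd 0
  simp at this
  linarith

theorem aux_diff {ψ : ℝ → ℝ} (h : IsSigmoid ψ) : Differentiable ℝ ψ :=
  h.contDiff.differentiable (by norm_num)

theorem aux_mono {ψ : ℝ → ℝ} (h : IsSigmoid ψ) : StrictMono ψ :=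
  strictMono_of_deriv_pos h.deriv_pos

theorem aux_dcont {ψ : ℝ → ℝ} (h : IsSigmoid ψ) : Continuous (deriv ψ) :=
  h.contDiff.continuous_deriv (by norm_num)

theorem aux_abs_le {ψ : ℝ → ℝ} (h : IsSigmoid ψ) (x : ℝ) : |ψ x| ≤ 1 := by
  rw [abs_le]
  exact ⟨(aux_mono h).monotone.le_of_tendsto h.tendsto_atBot x,
    (aux_mono h).monotone.ge_of_tendsto h.tendsto_atTop x⟩

theorem aux_deriv_le_pos {ψ : ℝ → ℝ} (h : IsSigmoid ψ) {x : ℝ} (hx : 0 < x) :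
    deriv ψ x ≤ 1 := by
  have hanti : AntitoneOn (deriv ψ) (Ioi 0) :=
    h.strictConcaveOn.concaveOn.antitoneOn_deriv (fun y _ => (aux_diff h y))
  have hlim : Tendsto (deriv ψ) (nhdsWithin 0 (Ioi 0)) (nhds 1) := by
    have := (aux_dcont h).tendsto 0
    rw [h.deriv_zero] at this
    exact this.mono_left nhdsWithin_le_nhds
  refine ge_of_tendsto hlim ?_
  filter_upwards [Ioo_mem_nhdsGT hx] with t ht
  exact hanti ht.1 hx ht.2.le

theorem aux_deriv_le {ψ : ℝ → ℝ} (h : IsSigmoid ψ) (x : ℝ) : deriv ψ x ≤ 1 := by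
  rcases lt_trichotomy x 0 with hx | hx | hx
  · have h1 := aux_deriv_le_pos h (x := -x) (by linarith)
    have h2 : deriv ψ (-x) = deriv ψ x := by
      have h3 : (fun y => ψ (-y)) = fun y => -ψ y := funext h.odd
      have h4 := congrFun (congrArg deriv h3) x
      have h5 : deriv (fun y => ψ (-y)) x = - deriv ψ (-x) := deriv_comp_neg ψ x
      have h6 : deriv (fun y => -ψ y) x = - deriv ψ x := deriv.fun_neg
      rw [h5, h6] at h4
      linarith
    linarith
  · rw [hx, h.deriv_zero]
  · exact aux_deriv_le_pos h hx

/-- incremental sector bound -/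
theorem aux_sector {ψ : ℝ → ℝ} (h : IsSigmoid ψ) (a b : ℝ) :
    (ψ b - ψ a) ^ 2 ≤ (ψ b - ψ a) * (b - a) := by
  have hm : Monotone (fun x => x - ψ x) := by
    apply monotone_of_deriv_nonneg
    · exact differentiable_id.sub (aux_diff h)
    · intro x
      have : deriv (fun x => x - ψ x) x = 1 - deriv ψ x := by
        rw [deriv_fun_sub differentiableAt_fun_id (aux_diff h x)]
        simp
      rw [this]
      linarith [aux_deriv_le h x]
  rcases le_total a b with hab | hab
  · have h1 := hm hab
    have h2 := (aux_mono h).monotone hab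
    simp only at h1
    nlinarith
  · have h1 := hm hab
    have h2 := (aux_mono h).monotone hab
    simp only at h1
    nlinarith

theorem aux_bregman {ψ : ℝ → ℝ} (h : IsSigmoid ψ) (a b : ℝ) :
    (ψ b - ψ a) ^ 2 / 2 ≤ (∫ t in (0:ℝ)..b, ψ t) - (∫ t in (0:ℝ)..a, ψ t) - (b - a) * ψ a := by
  have hc : Continuous ψ := (aux_diff h).continuous
  set g : ℝ → ℝ := fun b => (∫ t in (0:ℝ)..b, ψ t) - (∫ t in (0:ℝ)..a, ψ t) - (b - a) * ψ a
    - (ψ b - ψ a) ^ 2 / 2 with hg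
  have hd : ∀ x, HasDerivAt g ((ψ x - ψ a) * (1 - deriv ψ x)) x := by
    intro x
    have h1 : HasDerivAt (fun b => ∫ t in (0:ℝ)..b, ψ t) (ψ x) x :=
      intervalIntegral.integral_hasDerivAt_right (hc.intervalIntegrable _ _)
        (hc.stronglyMeasurableAtFilter _ _) hc.continuousAt
    have h2 : HasDerivAt ψ (deriv ψ x) x := (aux_diff h x).hasDerivAt
    have h3 := ((h1.sub_const (∫ t in (0:ℝ)..a, ψ t)).sub
      (((hasDerivAt_id x).sub_const a).mul_const (ψ a))).sub
      (((h2.sub_const (ψ a)).pow 2).div_const 2)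
    refine h3.congr_deriv ?_
    push_cast
    ring
  have hdiff : Differentiable ℝ g := fun x => (hd x).differentiableAt
  have hga : g a = 0 := by simp [hg]
  have key : 0 ≤ g b := by
    rcases le_total a b with hab | hab
    · have hm : MonotoneOn g (Ici a) := by
        apply monotoneOn_of_deriv_nonneg (convex_Ici a) hdiff.continuous.continuousOn
          hdiff.differentiableOn
        intro x hx
        rw [interior_Ici] at hx
        rw [(hd x).deriv]
        exact mul_nonneg (sub_nonneg.2 ((aux_mono h).monotone (le_of_lt hx)))
          (sub_nonneg.2 (aux_deriv_le h x))
      rw [← hga]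
      exact hm self_mem_Ici hab hab
    · have hm : AntitoneOn g (Iic a) := by
        apply antitoneOn_of_deriv_nonpos (convex_Iic a) hdiff.continuous.continuousOn
          hdiff.differentiableOn
        intro x hx
        rw [interior_Iic] at hx
        rw [(hd x).deriv]
        exact mul_nonpos_of_nonpos_of_nonneg (sub_nonpos.2 ((aux_mono h).monotone (le_of_lt hx)))
          (sub_nonneg.2 (aux_deriv_le h x))
      rw [← hga]
      exact hm hab self_mem_Iic hab
  simp only [hg] at key
  linarith

theorem aux_lower {ψ : ℝ → ℝ} (h : IsSigmoid ψ) (R : ℝ) (hR : 0 ≤ R) :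
    ∃ m : ℝ, 0 < m ∧ ∀ a ∈ Icc (-R) R, ∀ b ∈ Icc (-R) R, m * |b - a| ≤ |ψ b - ψ a| := by
  obtain ⟨z, hz, hmin⟩ := (isCompact_Icc (a := -R) (b := R)).exists_isMinOn
    ⟨0, by constructor <;> linarith⟩ (aux_dcont h).continuousOn
  refine ⟨deriv ψ z, h.deriv_pos z, ?_⟩
  have key : ∀ a ∈ Icc (-R) R, ∀ b ∈ Icc (-R) R, a ≤ b → deriv ψ z * |b - a| ≤ |ψ b - ψ a| := by
    intro a ha b hb hab
    rw [abs_of_nonneg (sub_nonneg.2 hab), abs_of_nonneg (sub_nonneg.2 ((aux_mono h).monotone hab))]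
    refine (convex_Icc (-R) R).mul_sub_le_image_sub_of_le_deriv (aux_diff h).continuous.continuousOn
      (aux_diff h).differentiableOn ?_ a ha b hb hab
    intro x hx
    exact hmin (interior_subset hx)
  intro a ha b hb
  rcases le_total a b with hab | hab
  · exact key a ha b hb hab
  · rw [abs_sub_comm b a, abs_sub_comm (ψ b)]
    exact key b hb a ha hab

theorem aux_posdef {n : ℕ} (hn : 2 ≤ n) (M : Matrix (Fin n) (Fin n) ℝ) (hM : M.PosDef) :
    ∃ c : ℝ, 0 < c ∧ ∀ s : Fin n → ℝ, c * ‖s‖ ^ 2 ≤ s ⬝ᵥ M *ᵥ s := by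
  haveI : Nonempty (Fin n) := ⟨⟨0, by omega⟩⟩
  have hcont : Continuous (fun s : Fin n → ℝ => s ⬝ᵥ M *ᵥ s) := by fun_prop
  obtain ⟨z, hz, hmin⟩ := (isCompact_sphere (0 : Fin n → ℝ) 1).exists_isMinOn
    (NormedSpace.sphere_nonempty.2 zero_le_one) hcont.continuousOn
  have hz0 : z ≠ 0 := by
    rintro rfl
    simp at hz
  refine ⟨z ⬝ᵥ M *ᵥ z, ?_, ?_⟩
  · simpa using hM.dotProduct_mulVec_pos hz0
  · intro s
    rcases eq_or_ne s 0 with rfl | hs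
    · simp
    · have hns : ‖s‖ ≠ 0 := norm_ne_zero_iff.2 hs
      have h1 : (‖s‖⁻¹ • s) ∈ Metric.sphere (0 : Fin n → ℝ) 1 := by
        simp [norm_smul, hns]
      have h2 : z ⬝ᵥ M *ᵥ z ≤ (‖s‖⁻¹ • s) ⬝ᵥ M *ᵥ (‖s‖⁻¹ • s) := hmin h1
      rw [mulVec_smul, smul_dotProduct, dotProduct_smul, smul_eq_mul, smul_eq_mul] at h2
      have h3 : 0 < ‖s‖ ^ 2 := by positivity
      calc z ⬝ᵥ M *ᵥ z * ‖s‖ ^ 2 ≤ (‖s‖⁻¹ * (‖s‖⁻¹ * (s ⬝ᵥ M *ᵥ s))) * ‖s‖ ^ 2 := by gcongr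
        _ = s ⬝ᵥ M *ᵥ s := by field_simp

theorem aux_q1 {n : ℕ} (A : Matrix (Fin n) (Fin n) ℝ) (δ : Fin n → ℝ) (p : ℝ) (s : Fin n → ℝ) :
    s ⬝ᵥ (Matrix.diagonal δ - p • A) *ᵥ s = ∑ i, δ i * s i ^ 2 - p * (s ⬝ᵥ A *ᵥ s) := by
  rw [sub_mulVec, dotProduct_sub, smul_mulVec, dotProduct_smul, smul_eq_mul]
  congr 1
  simp only [dotProduct, mulVec_diagonal]
  exact Finset.sum_congr rfl fun i _ => by ring

theorem aux_q2 {n : ℕ} (A : Matrix (Fin n) (Fin n) ℝ) (δ : Fin n → ℝ) (p ε : ℝ) (s : Fin n → ℝ) :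
    s ⬝ᵥ ((2 : ℝ) • (1 : Matrix (Fin n) (Fin n) ℝ) - ε • (Matrix.diagonal δ - p • A)) *ᵥ s
      = ∑ i, (2 - ε * δ i) * s i ^ 2 + ε * p * (s ⬝ᵥ A *ᵥ s) := by
  rw [sub_mulVec, dotProduct_sub, smul_mulVec, smul_mulVec, dotProduct_smul, dotProduct_smul,
    aux_q1, one_mulVec, smul_eq_mul, smul_eq_mul]
  have : ∑ i, (2 - ε * δ i) * s i ^ 2 = 2 * (s ⬝ᵥ s) - ε * ∑ i, δ i * s i ^ 2 := by
    simp only [dotProduct, Finset.mul_sum]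
    rw [← Finset.sum_sub_distrib]
    exact Finset.sum_congr rfl fun i _ => by ring
  rw [this]
  ring

/-- energy -/
noncomputable def auxV {n : ℕ} (A : Matrix (Fin n) (Fin n) ℝ) (δ : Fin n → ℝ) (p : ℝ)
    (ψ : Fin n → ℝ → ℝ) (x : Fin n → ℝ) : ℝ :=
  ∑ i, δ i * (x i * ψ i (x i) - ∫ t in (0:ℝ)..(x i), ψ i t)
    - p / 2 * ((fun i => ψ i (x i)) ⬝ᵥ A *ᵥ (fun i => ψ i (x i)))

theorem auxV_nonneg {n : ℕ} (A : Matrix (Fin n) (Fin n) ℝ) (δ : Fin n → ℝ) (hδ : ∀ i, 0 ≤ δ i)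
    (p : ℝ) (ψ : Fin n → ℝ → ℝ) (hψ : ∀ i, IsSigmoid (ψ i))
    (hpos1 : (Matrix.diagonal δ - p • A).PosDef) (x : Fin n → ℝ) :
    0 ≤ auxV A δ p ψ x := by
  have h1 := hpos1.posSemidef.dotProduct_mulVec_nonneg (fun i => ψ i (x i))
  simp only [star_trivial] at h1
  rw [aux_q1] at h1
  have h2 : ∑ i, δ i * (ψ i (x i)) ^ 2 ≤
      2 * ∑ i, δ i * (x i * ψ i (x i) - ∫ t in (0:ℝ)..(x i), ψ i t) := by
    rw [Finset.mul_sum]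
    refine Finset.sum_le_sum fun i _ => ?_
    have h3 := aux_bregman (hψ i) (x i) 0
    rw [aux_psi_zero (hψ i), intervalIntegral.integral_same] at h3
    nlinarith [hδ i, mul_le_mul_of_nonneg_left h3 (hδ i)]
  unfold auxV
  linarith

theorem auxV_descent {n : ℕ} (A : Matrix (Fin n) (Fin n) ℝ) (hA : A.IsSymm) (δ : Fin n → ℝ)
    (hδ : ∀ i, 0 ≤ δ i)
    (p : ℝ) (ψ : Fin n → ℝ → ℝ) (hψ : ∀ i, IsSigmoid (ψ i)) (ε : ℝ) (hε : 0 < ε)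
    (hεδ : ∀ i, ε * δ i ≤ 1) (x y : Fin n → ℝ)
    (hy : ∀ i, y i = (1 - ε * δ i) * x i + ε * p * (A *ᵥ (fun i => ψ i (x i))) i) :
    (fun i => ψ i (y i) - ψ i (x i)) ⬝ᵥ ((2 : ℝ) • (1 : Matrix (Fin n) (Fin n) ℝ) -
      ε • (Matrix.diagonal δ - p • A)) *ᵥ (fun i => ψ i (y i) - ψ i (x i)) ≤
    2 * ε * (auxV A δ p ψ x - auxV A δ p ψ y) := by
  rw [aux_q2]
  unfold auxV
  set s : Fin n → ℝ := fun i => ψ i (x i) with hs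
  set t : Fin n → ℝ := fun i => ψ i (y i) with ht
  set d : Fin n → ℝ := fun i => ψ i (y i) - ψ i (x i) with hd
  have htd : t = s + d := by
    ext i; simp [hs, ht, hd]
  have hsym : s ⬝ᵥ A *ᵥ d = d ⬝ᵥ A *ᵥ s := by
    rw [dotProduct_mulVec, ← mulVec_transpose, hA.eq, dotProduct_comm]
  have hq : t ⬝ᵥ A *ᵥ t = s ⬝ᵥ A *ᵥ s + 2 * (d ⬝ᵥ A *ᵥ s) + d ⬝ᵥ A *ᵥ d := by
    rw [htd, mulVec_add, add_dotProduct, dotProduct_add, dotProduct_add, hsym]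
    ring
  rw [hq]
  have hmain : ∑ i, (2 - ε * δ i) * d i ^ 2 ≤
      2 * ε * ∑ i, δ i * (x i * ψ i (x i) - ∫ t in (0:ℝ)..(x i), ψ i t)
      - 2 * ε * ∑ i, δ i * (y i * ψ i (y i) - ∫ t in (0:ℝ)..(y i), ψ i t)
      + 2 * ε * p * (d ⬝ᵥ A *ᵥ s) := by
    simp only [dotProduct, Finset.mul_sum]
    rw [← Finset.sum_sub_distrib, ← Finset.sum_add_distrib]
    refine Finset.sum_le_sum fun i _ => ?_
    have h1 := mul_le_mul_of_nonneg_left (aux_bregman (hψ i) (x i) (y i))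
      (mul_nonneg hε.le (hδ i))
    have h2 := mul_le_mul_of_nonneg_left (aux_sector (hψ i) (x i) (y i))
      (sub_nonneg.2 (hεδ i))
    have h3 : 2 * ε * p * (d i * (A *ᵥ s) i) = 2 * d i * (y i - (1 - ε * δ i) * x i) := by
      rw [hy i]; ring
    rw [h3]
    simp only [hd]
    nlinarith
  linarith

/-- Theorem 4(i): if `1 − ε·max_i δ_i ≥ 0` and both `L_π = Δ − πA`
and `2I − εL_π` are positive definite, then the origin is the unique fixed point of
`F(x) = (I − εΔ)x + επAψ(x)` and it is globally asymptotically stable: all iterates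
converge to `0`. -/
theorem stmt_13 {n : ℕ} (hn : 2 ≤ n)
    (A : Matrix (Fin n) (Fin n) ℝ) (hA : A.IsSymm)
    (hdiag : ∀ i, A i i = 0) (hrow : ∀ i, ∃ j, A i j ≠ 0)
    (δ : Fin n → ℝ) (hδ : ∀ i, δ i = ∑ j, |A i j|)
    (ψ : Fin n → ℝ → ℝ) (hψ : ∀ i, IsSigmoid (ψ i))
    (p : ℝ) (hp : 0 < p)
    (ε : ℝ) (hε : 0 < ε) (hεδ : ∀ i, ε * δ i ≤ 1)
    (hpos1 : (Matrix.diagonal δ - p • A).PosDef)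
    (hpos2 : ((2 : ℝ) • (1 : Matrix (Fin n) (Fin n) ℝ) -
      ε • (Matrix.diagonal δ - p • A)).PosDef)
    (F : (Fin n → ℝ) → Fin n → ℝ)
    (hF : ∀ x, F x = ((1 : Matrix (Fin n) (Fin n) ℝ) - ε • Matrix.diagonal δ).mulVec x +
      (ε * p) • A.mulVec (fun i => ψ i (x i))) :
    (∀ x : Fin n → ℝ, F x = x → x = 0) ∧
    ∀ x0 : Fin n → ℝ, Tendsto (fun k : ℕ => F^[k] x0) atTop (nhds 0) := by
  have hδ0 : ∀ i, 0 ≤ δ i := fun i => by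
    rw [hδ i]; exact Finset.sum_nonneg fun j _ => abs_nonneg _
  have hFi : ∀ x i, F x i = (1 - ε * δ i) * x i + ε * p * (A *ᵥ (fun i => ψ i (x i))) i := by
    intro x i
    rw [hF, sub_mulVec, one_mulVec, smul_mulVec]
    simp only [Pi.add_apply, Pi.sub_apply, Pi.smul_apply, mulVec_diagonal, smul_eq_mul]
    ring
  have hconv : ∀ x0 : Fin n → ℝ, Tendsto (fun k : ℕ => F^[k] x0) atTop (nhds 0) := by
    intro x0
    set X : ℕ → Fin n → ℝ := fun k => F^[k] x0 with hX
    have hXs : ∀ k, X (k+1) = F (X k) := fun k => Function.iterate_succ_apply' F k x0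
    -- boundedness
    set R : ℝ := max ‖x0‖ p with hR
    have hRp : p ≤ R := le_max_right _ _
    have hR0 : 0 ≤ R := hp.le.trans hRp
    have hb : ∀ k i, |X k i| ≤ R := by
      intro k
      induction k with
      | zero => exact fun i => (norm_le_pi_norm x0 i).trans (le_max_left _ _)
      | succ k ih =>
        intro i
        rw [hXs, hFi]
        have h1 : |(A *ᵥ (fun i => ψ i (X k i))) i| ≤ δ i := by
          rw [hδ i]
          simp only [mulVec, dotProduct]
          refine (Finset.abs_sum_le_sum_abs _ _).trans (Finset.sum_le_sum fun j _ => ?_)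
          rw [abs_mul]
          exact mul_le_of_le_one_right (abs_nonneg _) (aux_abs_le (hψ j) _)
        have h2 : 0 ≤ 1 - ε * δ i := sub_nonneg.2 (hεδ i)
        calc _ ≤ |(1 - ε * δ i) * X k i| + |ε * p * (A *ᵥ (fun i => ψ i (X k i))) i| := abs_add_le _ _
          _ = (1 - ε * δ i) * |X k i| + ε * p * |(A *ᵥ (fun i => ψ i (X k i))) i| := by
            rw [abs_mul, abs_mul, abs_of_nonneg h2, abs_of_pos (mul_pos hε hp)]
          _ ≤ (1 - ε * δ i) * R + ε * p * δ i := by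
            gcongr
            exact ih i
          _ ≤ R := by nlinarith [mul_le_mul_of_nonneg_left hRp (mul_nonneg hε.le (hδ0 i))]
    have hmem : ∀ k i, X k i ∈ Icc (-R) R := fun k i => abs_le.1 (hb k i)
    -- energy
    obtain ⟨c2, hc2, hq2⟩ := aux_posdef hn _ hpos2
    obtain ⟨c1, hc1, hq1⟩ := aux_posdef hn _ hpos1
    set V : ℕ → ℝ := fun k => auxV A δ p ψ (X k) with hV
    set D : ℕ → Fin n → ℝ := fun k i => ψ i (X (k+1) i) - ψ i (X k i) with hD
    have hdesc : ∀ k, c2 * ‖D k‖ ^ 2 ≤ 2 * ε * (V k - V (k+1)) := fun k =>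
      (hq2 _).trans (auxV_descent A hA δ hδ0 p ψ hψ ε hε hεδ (X k) (X (k+1))
        (fun i => by rw [hXs]; exact hFi _ i))
    have hVanti : Antitone V := by
      refine antitone_nat_of_succ_le fun k => ?_
      have h1 : 0 ≤ c2 * ‖D k‖ ^ 2 := by positivity
      have h2 := h1.trans (hdesc k)
      have h3 : 0 ≤ V k - V (k+1) := nonneg_of_mul_nonneg_right h2 (by positivity)
      linarith
    have hVlim := tendsto_atTop_ciInf hVanti
      ⟨0, by rintro _ ⟨k, rfl⟩; exact auxV_nonneg A δ hδ0 p ψ hψ hpos1 (X k)⟩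
    have hVd : Tendsto (fun k => 2 * ε * (V k - V (k+1))) atTop (nhds 0) := by
      have h1 := (hVlim.sub (hVlim.comp (tendsto_add_atTop_nat 1))).const_mul (2 * ε)
      simpa using h1
    have sqz : ∀ (c : ℝ) (_ : 0 < c) (u : ℕ → Fin n → ℝ) (w : ℕ → ℝ),
        (∀ k, c * ‖u k‖ ^ 2 ≤ w k) → Tendsto w atTop (nhds 0) →
        Tendsto (fun k => ‖u k‖) atTop (nhds 0) := by
      intro c hc u w huw hw
      have h1 : Tendsto (fun k => ‖u k‖ ^ 2) atTop (nhds 0) := by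
        have h2 : Tendsto (fun k => c⁻¹ * w k) atTop (nhds 0) := by simpa using hw.const_mul c⁻¹
        refine squeeze_zero (fun k => by positivity) (fun k => ?_) h2
        rw [inv_mul_eq_div, le_div_iff₀ hc, mul_comm]
        exact huw k
      have h3 := h1.sqrt
      simpa using h3
    have hDlim : Tendsto (fun k => ‖D k‖) atTop (nhds 0) := sqz c2 hc2 D _ hdesc hVd
    choose m hm hml using fun i => aux_lower (hψ i) R hR0
    have hdx : ∀ i, Tendsto (fun k => |X (k+1) i - X k i|) atTop (nhds 0) := by
      intro i
      have h2 : Tendsto (fun k => (m i)⁻¹ * ‖D k‖) atTop (nhds 0) := by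
        simpa using hDlim.const_mul (m i)⁻¹
      refine squeeze_zero (fun k => abs_nonneg _) (fun k => ?_) h2
      rw [inv_mul_eq_div, le_div_iff₀ (hm i), mul_comm]
      exact (hml i _ (hmem k i) _ (hmem (k+1) i)).trans (norm_le_pi_norm (D k) i)
    set S : ℕ → Fin n → ℝ := fun k i => ψ i (X k i) with hS
    have hSb : ∀ k, c1 * ‖S k‖ ^ 2 ≤ ε⁻¹ * ∑ i, |X (k+1) i - X k i| := by
      intro k
      refine (hq1 (S k)).trans ?_
      rw [aux_q1, inv_mul_eq_div, le_div_iff₀ hε]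
      have h0 : (∑ i, δ i * S k i ^ 2 - p * (S k ⬝ᵥ A *ᵥ S k)) * ε =
          ∑ i, (ε * δ i * S k i ^ 2 - ε * p * (S k i * (A *ᵥ S k) i)) := by
        rw [Finset.sum_sub_distrib, sub_mul, Finset.sum_mul]
        simp only [dotProduct]
        rw [← Finset.mul_sum]
        congr 1
        · exact Finset.sum_congr rfl fun i _ => by ring
        · ring
      rw [h0]
      refine Finset.sum_le_sum fun i _ => ?_
      have h1 : ε * p * (A *ᵥ S k) i = X (k+1) i - (1 - ε * δ i) * X k i := by
        rw [hXs, hFi]; ring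
      have h2 := aux_sector (hψ i) 0 (X k i)
      rw [aux_psi_zero (hψ i), sub_zero, sub_zero] at h2
      have h3 : S k i = ψ i (X k i) := rfl
      have h4 := mul_le_mul_of_nonneg_left h2 (mul_nonneg hε.le (hδ0 i))
      rw [← h3] at h4
      have h5 : ε * p * (S k i * (A *ᵥ S k) i)
          = S k i * (X (k+1) i - (1 - ε * δ i) * X k i) := by rw [← h1]; ring
      have h6 : -(S k i * (X (k+1) i - X k i)) ≤ |X (k+1) i - X k i| := by
        refine (neg_le_abs _).trans ?_
        rw [abs_mul]
        exact mul_le_of_le_one_left (abs_nonneg _) (aux_abs_le (hψ i) _)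
      rw [h5]
      nlinarith
    have hSlim : Tendsto (fun k => ‖S k‖) atTop (nhds 0) := by
      refine sqz c1 hc1 S _ hSb ?_
      have h1 := (tendsto_finset_sum Finset.univ (fun i _ => hdx i)).const_mul ε⁻¹
      simpa using h1
    rw [tendsto_pi_nhds]
    intro i
    rw [Pi.zero_apply, tendsto_zero_iff_abs_tendsto_zero]
    have h2 : Tendsto (fun k => (m i)⁻¹ * ‖S k‖) atTop (nhds 0) := by
      simpa using hSlim.const_mul (m i)⁻¹
    refine squeeze_zero (fun k => abs_nonneg _) (fun k => ?_) h2
    rw [inv_mul_eq_div, le_div_iff₀ (hm i), mul_comm]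
    have h3 := hml i 0 ⟨by linarith, hR0⟩ _ (hmem k i)
    rw [aux_psi_zero (hψ i), sub_zero, sub_zero] at h3
    exact h3.trans (norm_le_pi_norm (S k) i)
  refine ⟨fun x hx => ?_, hconv⟩
  have h1 := hconv x
  have h2 : (fun k : ℕ => F^[k] x) = fun _ => x := funext fun k => Function.iterate_fixed hx k
  rw [h2] at h1
  exact tendsto_nhds_unique tendsto_const_nhds h1
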